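/- Let X be a separable metrizable space. If the hyperspace K(X) with the Vietoris topology is hereditarily Baire, then the space P_r(X) of Radon Borel probability measures on X, with the weak topology, is hereditarily Baire. -/

import Mathlib

/-- The hyperspace of nonempty compact subsets of a topological space. -/
def Hyper (X : Type*) [TopologicalSpace X] : Type _ :=
  {K : Set X // IsCompact K ∧ K.Nonempty}

/-- The Vietoris topology on the hyperspace, generated by the sets
`{K : K ⊆ U}` and `{K : K ∩ U ≠ ∅}` for `U` open. -/
instance Hyper.instTopologicalSpace (X : Type*) [TopologicalSpace X] :
    TopologicalSpace (Hyper X) :=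
  TopologicalSpace.generateFrom
    ({s | ∃ U : Set X, IsOpen U ∧ s = {K : Hyper X | K.1 ⊆ U}} ∪
     {s | ∃ U : Set X, IsOpen U ∧ s = {K : Hyper X | (K.1 ∩ U).Nonempty}})

/-- A space is hereditarily Baire if every closed subspace is a Baire space. -/
def HereditarilyBaire (X : Type*) [TopologicalSpace X] : Prop :=
  ∀ C : Set X, IsClosed C → BaireSpace C

open MeasureTheory


section

open Set Filter Topology Metric

/-- The first `n` values of `f`, listed with the most recent one first. -/
def revPrefix (f : ℕ → ℕ) : ℕ → List ℕ
  | 0 => []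
  | n + 1 => f n :: revPrefix f n

theorem length_revPrefix (f : ℕ → ℕ) (n : ℕ) : (revPrefix f n).length = n := by
  induction n with
  | zero => rfl
  | succ n ih => simp [revPrefix, ih]

theorem exists_branch {P : List ℕ → Prop} (h0 : P [])
    (hstep : ∀ s, P s → ∃ k, P (k :: s)) : ∃ f, ∀ n, P (revPrefix f n) := by
  choose! c hc using hstep
  let g : ℕ → List ℕ := fun n => Nat.rec [] (fun _ s => c s :: s) n
  refine ⟨fun n => c (g n), fun n => ?_⟩
  suffices revPrefix (fun n => c (g n)) n = g n ∧ P (g n) by rw [this.1]; exact this.2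
  induction n with
  | zero => exact ⟨rfl, h0⟩
  | succ n ih => exact ⟨by simp only [revPrefix, ih.1]; rfl, hc _ ih.2⟩

namespace Hyper

variable {X : Type*} [TopologicalSpace X]

theorem isOpen_subset {U : Set X} (hU : IsOpen U) : IsOpen {K : Hyper X | K.1 ⊆ U} :=
  TopologicalSpace.isOpen_generateFrom_of_mem (Or.inl ⟨U, hU, rfl⟩)

theorem isOpen_inter_nonempty {U : Set X} (hU : IsOpen U) :
    IsOpen {K : Hyper X | (K.1 ∩ U).Nonempty} :=
  TopologicalSpace.isOpen_generateFrom_of_mem (Or.inr ⟨U, hU, rfl⟩)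

theorem isClosed_subset {F : Set X} (hF : IsClosed F) : IsClosed {K : Hyper X | K.1 ⊆ F} := by
  rw [← isOpen_compl_iff]
  convert isOpen_inter_nonempty hF.isOpen_compl using 1
  ext K
  exact not_subset

theorem isClosed_superset [T1Space X] (B : Set X) : IsClosed {K : Hyper X | B ⊆ K.1} := by
  have : {K : Hyper X | B ⊆ K.1} = ⋂ x ∈ B, {K : Hyper X | K.1 ⊆ {x}ᶜ}ᶜ := by
    ext K
    simp [subset_def]
  rw [this]
  exact isClosed_biInter fun x _ =>
    (isOpen_subset (isOpen_compl_singleton (x := x))).isClosed_compl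

theorem isClosed_singleton [T2Space X] (K : Hyper X) :
    IsClosed ({K} : Set (Hyper X)) := by
  have : ({K} : Set (Hyper X)) = {L | L.1 ⊆ K.1} ∩ {L | K.1 ⊆ L.1} := by
    ext L
    simp only [mem_singleton_iff, mem_inter_iff, mem_ofPred_eq, ← subset_antisymm_iff]
    exact Subtype.ext_iff
  rw [this]
  exact (isClosed_subset K.2.1.isClosed).inter (isClosed_superset _)

end Hyper

/-- A tree of compact sets `B s` in `X` with closed neighbourhoods `A s` in `Z`, shrinking along
the immediate successors of each node and along each branch. -/
structure CompactTree {X Z : Type*} [TopologicalSpace X] [MetricSpace Z] (e : X → Z)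
    (B : List ℕ → Hyper X) (A : List ℕ → Set Z) : Prop where
  mono : ∀ k s, (B s).1 ⊆ (B (k :: s)).1
  image_subset : ∀ s, e '' (B s).1 ⊆ A s
  anti : ∀ k s, A (k :: s) ⊆ A s
  subset_cthickening_pred : ∀ (k : ℕ) s, A (k :: s) ⊆ cthickening (1 / ((k : ℝ) + 1)) (e '' (B s).1)
  subset_cthickening : ∀ s, A s ⊆ cthickening (1 / ((s.length : ℝ) + 1)) (e '' (B s).1)

theorem exists_one_div_le {δ : ℝ} (hδ : 0 < δ) : ∃ N : ℕ, ∀ k ≥ N, 1 / ((k : ℝ) + 1) ≤ δ := by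
  obtain ⟨N, hN⟩ := exists_nat_one_div_lt hδ
  exact ⟨N, fun k hk => (Nat.one_div_le_one_div hk).trans hN.le⟩

theorem mem_of_forall_mem_cthickening {Z : Type*} [MetricSpace Z] {K : Set Z} (hK : IsClosed K)
    {z : Z} (h : ∀ N : ℕ, ∃ k ≥ N, z ∈ cthickening (1 / ((k : ℝ) + 1)) K) : z ∈ K := by
  rw [← hK.closure_eq, closure_eq_iInter_cthickening]
  simp only [mem_iInter]
  intro δ hδ
  obtain ⟨N, hN⟩ := exists_one_div_le hδ
  obtain ⟨k, hk, hz⟩ := h N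
  exact cthickening_mono (hN k hk) _ hz

namespace CompactTree

variable {X Z : Type*} [TopologicalSpace X] [MetricSpace Z] {e : X → Z}
  {B : List ℕ → Hyper X} {A : List ℕ → Set Z}

theorem mono_suffix (hT : CompactTree e B A) {s t : List ℕ} (h : s <:+ t) : (B s).1 ⊆ (B t).1 := by
  obtain ⟨l, rfl⟩ := h
  induction l with
  | nil => rfl
  | cons k l ih => exact ih.trans (hT.mono k _)

theorem anti_suffix (hT : CompactTree e B A) {s t : List ℕ} (h : s <:+ t) : A t ⊆ A s := by
  obtain ⟨l, rfl⟩ := h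
  induction l with
  | nil => rfl
  | cons k l ih => exact (hT.anti k _).trans ih

theorem tendsto (hT : CompactTree e B A) (he : IsEmbedding e) (s : List ℕ) :
    Tendsto (fun k => B (k :: s)) atTop (𝓝 (B s)) := by
  refine TopologicalSpace.tendsto_nhds_generateFrom_iff.2 ?_
  rintro _ (⟨U, hU, rfl⟩ | ⟨U, hU, rfl⟩) hs
  · obtain ⟨V, hV, rfl⟩ := he.isInducing.isOpen_iff.1 hU
    obtain ⟨δ, hδ, hδV⟩ := ((B s).2.1.image he.continuous).exists_cthickening_subset_open hV
      (image_subset_iff.2 hs)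
    obtain ⟨N, hN⟩ := exists_one_div_le hδ
    refine mem_atTop_sets.2 ⟨N, fun k hk => ?_⟩
    exact image_subset_iff.1 ((hT.image_subset _).trans ((hT.subset_cthickening_pred k s).trans
      ((cthickening_mono (hN k hk) _).trans hδV)))
  · exact Eventually.of_forall fun k => hs.mono (inter_subset_inter_left _ (hT.mono k s))

theorem exists_branch_of_mem_closure [T2Space X] (hT : CompactTree e B A) (he : IsEmbedding e)
    {K : Hyper X} {P : List ℕ → Prop} (h0 : P []) (hstep : ∀ s, P s → ∃ k, P (k :: s))
    (hP : ∀ s, P s → K ∈ closure (B '' {t | s <:+ t})) :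
    ∃ f, ∀ z, (∀ n, z ∈ A (revPrefix f n)) → z ∈ range e := by
  obtain ⟨f, hf⟩ := exists_branch h0 hstep
  refine ⟨f, fun z hz => image_subset_range e K.1 ?_⟩
  refine mem_of_forall_mem_cthickening (K.2.1.image he.continuous).isClosed fun N => ⟨N, le_rfl, ?_⟩
  have h1 := hT.subset_cthickening _ (hz N)
  rw [length_revPrefix] at h1
  refine cthickening_subset_of_subset _ (image_mono ?_) h1
  have : closure (B '' {t | revPrefix f N <:+ t}) ⊆ {K : Hyper X | (B (revPrefix f N)).1 ⊆ K.1} :=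
    closure_minimal (image_subset_iff.2 fun t ht => hT.mono_suffix ht) (Hyper.isClosed_superset _)
  exact this (hP _ (hf N))

theorem exists_cons_mem_closure [T2Space X] (hT : CompactTree e B A) (he : IsEmbedding e)
    {K : Hyper X} {s : List ℕ} (hKs : K ≠ B s) (hK : K ∈ closure (B '' {t | s <:+ t})) :
    ∃ k, K ∈ closure (B '' {t | k :: s <:+ t}) := by
  by_contra! hcon
  have hsup : (B s).1 ⊆ K.1 :=
    closure_minimal (t := {K : Hyper X | (B s).1 ⊆ K.1})
      (image_subset_iff.2 fun t ht => hT.mono_suffix ht) (Hyper.isClosed_superset _) hK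
  have hsub : K.1 ⊆ (B s).1 := by
    intro x hx
    rw [← he.injective.mem_set_image]
    refine mem_of_forall_mem_cthickening ((B s).2.1.image he.continuous).isClosed
      fun N => ⟨N, le_rfl, ?_⟩
    have hsplit : B '' {t | s <:+ t} ⊆ ({B s} ∪ ⋃ k ∈ Iio N, B '' {t | k :: s <:+ t}) ∪
        {L | L.1 ⊆ e ⁻¹' cthickening (1 / ((N : ℝ) + 1)) (e '' (B s).1)} := by
      rintro _ ⟨t, ⟨l, rfl⟩, rfl⟩
      rcases List.eq_nil_or_concat l with rfl | ⟨l, k, rfl⟩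
      · exact Or.inl (Or.inl rfl)
      · have hk : k :: s <:+ l.concat k ++ s := ⟨l, by simp⟩
        rcases lt_or_ge k N with hkN | hkN
        · exact Or.inl (Or.inr (mem_biUnion (mem_Iio.2 hkN) ⟨_, hk, rfl⟩))
        · refine Or.inr (image_subset_iff.1 ((hT.image_subset _).trans
            ((hT.anti_suffix hk).trans ((hT.subset_cthickening_pred k s).trans
              (cthickening_mono (Nat.one_div_le_one_div hkN) _)))))
    have hcl := closure_mono hsplit hK
    rw [closure_union, closure_union, (finite_Iio N).closure_biUnion,
      (Hyper.isClosed_singleton _).closure_eq, (Hyper.isClosed_subset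
        (isClosed_cthickening.preimage he.continuous)).closure_eq] at hcl
    rcases hcl with (h | h) | h
    · exact absurd h hKs
    · simp only [mem_iUnion] at h
      obtain ⟨k, -, hk⟩ := h
      exact absurd hk (hcon k)
    · exact h hx
  exact hKs (Subtype.ext (hsub.antisymm hsup))

theorem exists_branch_subset_range [T2Space X] (hT : CompactTree e B A) (he : IsEmbedding e)
    (h : HereditarilyBaire (Hyper X)) :
    ∃ f, ∀ z, (∀ n, z ∈ A (revPrefix f n)) → z ∈ range e := by
  by_cases hex : ∃ K ∈ closure (range B), K ∉ range B
  · obtain ⟨K, hK, hKB⟩ := hex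
    refine hT.exists_branch_of_mem_closure he (K := K)
      (P := fun s => K ∈ closure (B '' {t | s <:+ t})) (by simpa using hK) (fun s hs => ?_)
      fun s hs => hs
    exact hT.exists_cons_mem_closure he (fun h => hKB ⟨s, h.symm⟩) hs
  push Not at hex
  have hbaire := h _ (isClosed_closure (s := range B))
  have : Nonempty (closure (range B)) := ⟨B [], subset_closure ⟨[], rfl⟩⟩
  obtain ⟨u, ⟨K, hKB⟩, hKu⟩ := nonempty_interior_of_iUnion_of_closed
    (f := fun s : List ℕ => ((↑) : closure (range B) → Hyper X) ⁻¹' {B s})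
    (fun s => (Hyper.isClosed_singleton _).preimage continuous_subtype_val) (by
      refine eq_univ_of_forall fun K => ?_
      obtain ⟨s, hs⟩ := hex _ K.2
      exact mem_iUnion.2 ⟨s, hs.symm⟩)
  obtain rfl : K = B u := by simpa using interior_subset hKu
  rw [mem_interior_iff_mem_nhds, nhds_subtype_eq_comap] at hKu
  obtain ⟨U, hU, hUu⟩ := hKu
  refine hT.exists_branch_of_mem_closure he (K := B u)
    (P := fun s => ∃ t, s <:+ t ∧ B t = B u) ⟨u, List.nil_suffix, rfl⟩ ?_
    fun s ⟨t, hst, ht⟩ => subset_closure ⟨t, hst, ht⟩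
  rintro s ⟨_, ⟨l, rfl⟩, ht⟩
  rcases List.eq_nil_or_concat l with rfl | ⟨l, k, rfl⟩
  · have hev := hT.tendsto he s
    rw [List.nil_append] at ht
    rw [ht] at hev
    obtain ⟨k, hk⟩ := (hev.eventually_mem hU).exists
    exact ⟨k, k :: s, List.suffix_rfl, @hUu ⟨B (k :: s), subset_closure ⟨_, rfl⟩⟩ hk⟩
  · exact ⟨k, _, ⟨l, by simp⟩, ht⟩

end CompactTree

/-- A form of the Menger covering property for a subset `Y` of a topological space: out of every
sequence of increasing open covers of `Y` one can select one member each so as to cover `Y`. -/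
def IsMengerSet {Z : Type*} [TopologicalSpace Z] (Y : Set Z) : Prop :=
  ∀ V : ℕ → ℕ → Set Z, (∀ n k, IsOpen (V n k)) → (∀ n, Monotone (V n)) →
    (∀ n, ∀ y ∈ Y, ∃ k, y ∈ V n k) → ∃ h : ℕ → ℕ, ∀ y ∈ Y, ∃ n, y ∈ V n (h n)

section Menger

variable {X Z : Type*} [TopologicalSpace X] [MetricSpace Z]

/-- The tree whose node `k :: s` is obtained from the node `(O, B)` at `s` by intersecting `O` with
the `1 / (k + 1)`-neighbourhood of `B` and enlarging `B` by `ext`. -/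
noncomputable def thickeningTree (e : X → Z) (ext : Set X → Hyper X → ℕ → Hyper X) (B₀ : Hyper X) :
    List ℕ → Set X × Hyper X
  | [] => (univ, ext univ B₀ 0)
  | k :: s =>
    let O := (thickeningTree e ext B₀ s).1 ∩
      e ⁻¹' thickening (1 / ((k : ℝ) + 1)) (e '' (thickeningTree e ext B₀ s).2.1)
    (O, ext O (thickeningTree e ext B₀ s).2 (s.length + 1))

theorem exists_compact_extension [CompactSpace Z] {e : X → Z} (he : IsEmbedding e) {K : Set Z}
    (hK : IsClosed K) (hKe : K ⊆ range e) (O : Set X) (B : Hyper X) {ε : ℝ} (hε : 0 < ε) :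
    ∃ B' : Hyper X, B.1 ⊆ B'.1 ∧ closure (e '' O) ∩ K ⊆ e '' B'.1 ∧
      closure (e '' O) ⊆ cthickening ε (e '' B'.1) ∧
      e '' B'.1 ⊆ closure (e '' O) ∪ e '' B.1 := by
  obtain ⟨t, htO, htfin, ht⟩ := finite_approx_of_totallyBounded
    (isCompact_univ.totallyBounded.subset (subset_univ (e '' O))) ε hε
  have hC : IsCompact (e ⁻¹' (closure (e '' O) ∩ K)) :=
    he.isInducing.isCompact_preimage' (isClosed_closure.inter hK).isCompact
      (inter_subset_right.trans hKe)
  have hF : (e ⁻¹' t).Finite := htfin.preimage he.injective.injOn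
  have hte : t ⊆ range e := htO.trans (image_subset_range _ _)
  refine ⟨⟨B.1 ∪ (e ⁻¹' (closure (e '' O) ∩ K) ∪ e ⁻¹' t),
    B.2.1.union (hC.union hF.isCompact), B.2.2.mono subset_union_left⟩, subset_union_left, ?_, ?_, ?_⟩
  · rw [image_union, image_union, image_preimage_eq_of_subset (inter_subset_right.trans hKe)]
    exact subset_union_left.trans subset_union_right
  · refine closure_minimal (ht.trans ?_) isClosed_cthickening
    simp only [iUnion_subset_iff]
    intro y hy
    refine (ball_subset_thickening ?_ ε).trans (thickening_subset_cthickening _ _)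
    rw [image_union, image_union, image_preimage_eq_of_subset hte]
    exact Or.inr (Or.inr hy)
  · rw [image_union, image_union, image_preimage_eq_of_subset (inter_subset_right.trans hKe),
      image_preimage_eq_of_subset hte]
    exact union_subset subset_union_right (union_subset (inter_subset_left.trans subset_union_left)
      (htO.trans (subset_closure.trans subset_union_left)))

/-- If the hyperspace of `X` is hereditarily Baire, then the remainder of `X` in a metrizable
compactification is Menger. -/
theorem isMengerSet_compl_range [Nonempty X] [CompactSpace Z] {e : X → Z} (he : IsEmbedding e)
    (hd : DenseRange e) (h : HereditarilyBaire (Hyper X)) : IsMengerSet (range e)ᶜ := by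
  intro V hVo hVm hVc
  have : T2Space X := he.t2Space
  have hK : ∀ n, (⋃ k, V n k)ᶜ ⊆ range e := by
    intro n z hz
    by_contra hze
    exact hz (mem_iUnion.2 (hVc n z hze))
  choose ext hext1 hext2 hext3 hext4 using fun O B (n : ℕ) =>
    exists_compact_extension he (isOpen_iUnion (hVo n)).isClosed_compl (hK n) O B
      (Nat.one_div_pos_of_nat (α := ℝ) (n := n))
  obtain ⟨x₀⟩ := ‹Nonempty X›
  let T := thickeningTree e ext ⟨{x₀}, isCompact_singleton, singleton_nonempty _⟩
  let A := fun s => closure (e '' (T s).1)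
  have hA : ∀ (k : ℕ) s, A s ∩ thickening (1 / ((k : ℝ) + 1)) (e '' (T s).2.1) ⊆ A (k :: s) := by
    intro k s
    rw [inter_comm]
    refine isOpen_thickening.inter_closure.trans (closure_mono ?_)
    rintro _ ⟨hx, x, hxO, rfl⟩
    exact ⟨x, ⟨hxO, hx⟩, rfl⟩
  have htree : CompactTree e (fun s => (T s).2) A := by
    refine ⟨fun k s => hext1 _ _ _, fun s => ?_, fun k s => ?_, fun k s => ?_, fun s => ?_⟩
    · induction s with
      | nil =>
        have : A [] = univ := by simp [A, T, thickeningTree, hd.closure_range]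
        simp [this]
      | cons k s ih =>
        refine (hext4 _ _ _).trans (union_subset subset_rfl ?_)
        exact (subset_inter ih (self_subset_thickening Nat.one_div_pos_of_nat _)).trans (hA k s)
    · exact closure_mono (image_mono inter_subset_left)
    · refine closure_minimal (image_subset_iff.2 ?_) isClosed_cthickening
      exact inter_subset_right.trans (preimage_mono (thickening_subset_cthickening _ _))
    · cases s <;> exact hext3 _ _ _
  obtain ⟨f, hf⟩ := htree.exists_branch_subset_range he h
  have hsel : ∀ n, ∃ k, A (revPrefix f n) \
      thickening (1 / ((f n : ℝ) + 1)) (e '' (T (revPrefix f n)).2.1) ⊆ V n k := by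
    intro n
    refine (isClosed_closure.isCompact.diff isOpen_thickening).elim_directed_cover (V n) (hVo n)
      ?_ (hVm n).directed_le
    rintro z ⟨hzA, hz⟩
    by_contra hzV
    refine hz (self_subset_thickening Nat.one_div_pos_of_nat _ ?_)
    have key : ∀ s : List ℕ, A s ∩ (⋃ k, V s.length k)ᶜ ⊆ e '' (T s).2.1 := by
      intro s
      cases s <;> exact hext2 _ _ _
    refine key _ ⟨hzA, ?_⟩
    rwa [length_revPrefix]
  choose g hg using hsel
  refine ⟨g, fun y hy => ?_⟩
  by_contra! hcon
  refine hy (hf y fun n => ?_)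
  induction n with
  | zero => simp [A, T, thickeningTree, revPrefix, hd.closure_range]
  | succ n ih =>
    refine hA _ _ ⟨ih, ?_⟩
    by_contra hyn
    exact hcon n (hg n ⟨ih, hyn⟩)

end Menger

section Game

variable {Z : Type*} [TopologicalSpace Z]

theorem finite_setOf_length_eq_forall_le (n a : ℕ) :
    {s : List ℕ | s.length = n ∧ ∀ x ∈ s, x ≤ a}.Finite := by
  induction n with
  | zero =>
    refine (finite_singleton []).subset ?_
    rintro s ⟨hs, -⟩
    exact List.length_eq_zero_iff.1 hs
  | succ n ih =>
    refine ((finite_Iic a).image2 List.cons ih).subset ?_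
    rintro s ⟨hs, hsa⟩
    obtain ⟨x, t, rfl⟩ := List.exists_cons_of_length_eq_add_one hs
    simp only [List.length_cons, add_left_inj, List.mem_cons, forall_eq_or_imp] at hs hsa
    exact ⟨x, hsa.1, t, ⟨hs, hsa.2⟩, rfl⟩

/-- The points whose chain of successive winning bounds against `W` stays below `k` for `n` steps:
a bound `a` may be followed by `k` if the `k`-th move covers the point at every position of length
`n` with entries at most `a`. -/
def boundChain (W : List ℕ → ℕ → Set Z) : ℕ → ℕ → Set Z
  | 0, _ => univ
  | n + 1, k => ⋃ a ∈ Iic k, boundChain W n a ∩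
      ⋂ s ∈ {s : List ℕ | s.length = n ∧ ∀ x ∈ s, x ≤ a}, W s k

/-- Hurewicz's theorem: if `Y` is Menger then the first player has no winning strategy in the
Menger game on `Y`. -/
theorem IsMengerSet.exists_play {Y : Set Z} (hY : IsMengerSet Y) {W : List ℕ → ℕ → Set Z}
    (hWo : ∀ s k, IsOpen (W s k)) (hWm : ∀ s, Monotone (W s))
    (hWc : ∀ s, ∀ y ∈ Y, ∃ k, y ∈ W s k) :
    ∃ f : ℕ → ℕ, ∀ y ∈ Y, ∃ n, y ∈ W (revPrefix f n) (f n) := by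
  have ho : ∀ n k, IsOpen (boundChain W n k) := by
    intro n
    induction n with
    | zero => exact fun _ => isOpen_univ
    | succ n ih =>
      exact fun k => isOpen_biUnion fun a _ => (ih a).inter
        ((finite_setOf_length_eq_forall_le n a).isOpen_biInter fun s _ => hWo s k)
  have hm : ∀ n, Monotone (boundChain W n) := by
    intro n
    cases n with
    | zero => exact monotone_const
    | succ n =>
      intro k l hkl
      exact biUnion_mono (Iic_subset_Iic.2 hkl) fun a _ => inter_subset_inter_right _
        (iInter₂_mono fun s _ => hWm s hkl)
  have hc : ∀ n, ∀ y ∈ Y, ∃ k, y ∈ boundChain W n k := by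
    intro n y hy
    induction n with
    | zero => exact ⟨0, mem_univ _⟩
    | succ n ih =>
      obtain ⟨a, ha⟩ := ih
      choose c hc using fun s => hWc s y hy
      obtain ⟨b, hb⟩ := ((finite_setOf_length_eq_forall_le n a).image c).bddAbove
      refine ⟨max a b, mem_biUnion (mem_Iic.2 (le_max_left a b)) ⟨ha, mem_iInter₂.2 fun s hs => ?_⟩⟩
      exact hWm s ((hb (mem_image_of_mem c hs)).trans (le_max_right _ _)) (hc s)
  obtain ⟨h, hh⟩ := hY (fun n => boundChain W (n + 1)) (fun n => ho _) (fun n => hm _) fun n => hc _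
  let f : ℕ → ℕ := fun n => ∑ i ∈ Finset.range (n + 1), h i
  have hf : Monotone f := fun m n hmn =>
    Finset.sum_le_sum_of_subset (Finset.range_mono (Nat.succ_le_succ hmn))
  have hhf : ∀ n, h n ≤ f n := fun n =>
    Finset.single_le_sum (fun _ _ => Nat.zero_le _) (Finset.self_mem_range_succ n)
  have hpre : ∀ n, ∀ x ∈ revPrefix f (n + 1), x ≤ f n := by
    intro n
    induction n with
    | zero => simp [revPrefix]
    | succ n ih =>
      intro x hx
      rcases List.mem_cons.1 hx with rfl | hx
      · exact le_rfl
      · exact (ih x hx).trans (hf n.le_succ)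
  refine ⟨f, fun y hy => ?_⟩
  by_contra! hcon
  have key : ∀ n, ∀ k ≤ f n, y ∉ boundChain W (n + 1) k := by
    intro n
    induction n with
    | zero =>
      intro k hk hyk
      obtain ⟨a, -, -, hyW⟩ := mem_iUnion₂.1 hyk
      exact hcon 0 (hWm _ hk (mem_iInter₂.1 hyW [] (by simp)))
    | succ n ih =>
      intro k hk hyk
      obtain ⟨a, -, hya, hyW⟩ := mem_iUnion₂.1 hyk
      have ha : f n < a := by
        by_contra! ha
        exact ih a ha hya
      exact hcon (n + 1) (hWm _ hk (mem_iInter₂.1 hyW (revPrefix f (n + 1))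
        ⟨length_revPrefix f _, fun x hx => (hpre n x hx).trans ha.le⟩))
  obtain ⟨n, hn⟩ := hh y hy
  exact key n (h n) (hhf n) hn

theorem IsMengerSet.prod_nat {Y : Set Z} (hY : IsMengerSet Y) :
    IsMengerSet (Y ×ˢ (univ : Set ℕ)) := by
  intro V hVo hVm hVc
  choose h hh using fun m => hY (fun n k => (fun z => (z, m)) ⁻¹' V (m + n) k)
    (fun n k => (hVo _ k).preimage (Continuous.prodMk_left m))
    (fun n _ _ hkl => preimage_mono (hVm _ hkl)) fun n y hy => hVc _ (y, m) ⟨hy, mem_univ _⟩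
  refine ⟨fun n => ∑ m ∈ Finset.range (n + 1), h m (n - m), ?_⟩
  rintro ⟨y, m⟩ ⟨hy, -⟩
  obtain ⟨n, hn⟩ := hh m y hy
  refine ⟨m + n, hVm _ ?_ hn⟩
  have := Finset.single_le_sum (f := fun i => h i (m + n - i)) (fun _ _ => Nat.zero_le _)
    (Finset.mem_range.2 (show m < m + n + 1 by omega))
  simpa using this

/-- In the Menger game on a Menger set, the second player can defeat any given strategy in such a
way that every point is covered infinitely often. -/
theorem IsMengerSet.exists_play_frequently {Y : Set Z} (hY : IsMengerSet Y)
    {W : List ℕ → ℕ → Set Z} (hWo : ∀ s k, IsOpen (W s k)) (hWm : ∀ s, Monotone (W s))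
    (hWc : ∀ s, ∀ y ∈ Y, ∃ k, y ∈ W s k) :
    ∃ f : ℕ → ℕ, ∀ y ∈ Y, ∀ m, ∃ n ≥ m, y ∈ W (revPrefix f n) (f n) := by
  obtain ⟨f, hf⟩ := hY.prod_nat.exists_play (W := fun s k => W s k ×ˢ Iic k)
    (fun s k => (hWo s k).prod (isOpen_discrete _))
    (fun s k l hkl => prod_mono (hWm s hkl) (Iic_subset_Iic.2 hkl)) (by
      rintro s ⟨y, m⟩ ⟨hy, -⟩
      obtain ⟨k, hk⟩ := hWc s y hy
      exact ⟨max k m, hWm s (le_max_left k m) hk, le_max_right k m⟩)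
  refine ⟨f, fun y hy m => ?_⟩
  by_contra! hcon
  obtain ⟨n, hn, hn'⟩ := hf (y, ∑ i ∈ Finset.range m, f i + 1) ⟨hy, mem_univ _⟩
  have hnm : n < m := by
    by_contra! hnm
    exact hcon n hnm hn
  have h1 := Finset.single_le_sum (f := f) (fun _ _ => Nat.zero_le _) (Finset.mem_range.2 hnm)
  simp only [mem_Iic] at hn'
  omega

end Game

open scoped ENNReal

section Measure

variable {X Z : Type*} [MetricSpace Z] [MeasurableSpace Z] [BorelSpace Z]

/-- The set `R` carries `μ` up to arbitrarily small error on compact subsets. -/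
def IsTightOn (R : Set Z) (μ : ProbabilityMeasure Z) : Prop :=
  ∀ ε : ℝ≥0∞, 0 < ε → ∃ K ⊆ R, IsCompact K ∧ (μ : Measure Z) Kᶜ < ε

theorem isOpen_setOf_measure_closed_lt {F : Set Z} (hF : IsClosed F) (c : ℝ≥0∞) :
    IsOpen {μ : ProbabilityMeasure Z | (μ : Measure Z) F < c} := by
  refine isOpen_iff_mem_nhds.2 fun μ hμ => ?_
  exact eventually_lt_of_limsup_lt
    ((ProbabilityMeasure.limsup_measure_closed_le_of_tendsto tendsto_id hF).trans_lt hμ)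

theorem exists_nested_open [CompactSpace Z] {C : Type*} {j : C → ProbabilityMeasure Z}
    {R : Set Z} (ht : ∀ c, IsTightOn R (j c)) {O G : Set (ProbabilityMeasure Z)} (hO : IsOpen O)
    (hne : (j ⁻¹' O).Nonempty) (hG : IsOpen G)
    (hd : ∀ O' : Set (ProbabilityMeasure Z), IsOpen O' → (j ⁻¹' O').Nonempty →
      (j ⁻¹' (O' ∩ G)).Nonempty) {ε : ℝ≥0∞} (hε : 0 < ε) :
    ∃ K ⊆ R, IsCompact K ∧ ∀ k : ℕ, ∃ O' : Set (ProbabilityMeasure Z), (IsOpen O' ∧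
      (j ⁻¹' O').Nonempty) ∧ closure O' ⊆ O ∩ G ∧
      ∀ μ ∈ closure O', (μ : Measure Z) (thickening (1 / ((k : ℝ) + 1)) K)ᶜ < ε := by
  obtain ⟨c, hc⟩ := hne
  obtain ⟨K, hKR, hK, hKε⟩ := ht c ε hε
  refine ⟨K, hKR, hK, fun k => ?_⟩
  let H := {μ : ProbabilityMeasure Z | (μ : Measure Z) (thickening (1 / ((k : ℝ) + 1)) K)ᶜ < ε}
  have hH : IsOpen H := isOpen_setOf_measure_closed_lt isOpen_thickening.isClosed_compl ε
  have hcH : j c ∈ H := (measure_mono (compl_subset_compl.2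
    (self_subset_thickening Nat.one_div_pos_of_nat K))).trans_lt hKε
  obtain ⟨d, ⟨hdO, hdH⟩, hdG⟩ := hd (O ∩ H) (hO.inter hH) ⟨c, hc, hcH⟩
  obtain ⟨S, hS, hSc, hSs⟩ := exists_mem_nhds_isClosed_subset
    (((hO.inter hH).inter hG).mem_nhds ⟨⟨hdO, hdH⟩, hdG⟩)
  have hcl : closure (interior S) ⊆ O ∩ H ∩ G :=
    (closure_minimal interior_subset hSc).trans hSs
  exact ⟨interior S, ⟨isOpen_interior, d, mem_interior_iff_mem_nhds.2 hS⟩,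
    fun μ hμ => ⟨(hcl hμ).1.1, (hcl hμ).2⟩, fun μ hμ => (hcl hμ).1.2⟩

/-- A space of tight measures on `R`, containing all tight measures in its closure, is Baire as
soon as the complement of `R` is Menger. -/
theorem baireSpace_of_isTightOn [CompactSpace Z] {C : Type*} [TopologicalSpace C]
    {j : C → ProbabilityMeasure Z} (hj : IsInducing j) {R : Set Z} (hR : IsMengerSet Rᶜ)
    (ht : ∀ c, IsTightOn R (j c)) (hcl : ∀ μ ∈ closure (range j), IsTightOn R μ → μ ∈ range j) :
    BaireSpace C := by
  refine ⟨fun D hDo hDd => dense_iff_inter_open.2 fun U hU hUne => ?_⟩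
  obtain ⟨O₀, hO₀, rfl⟩ := hj.isOpen_iff.1 hU
  choose G hGo hGD using fun n => hj.isOpen_iff.1 (hDo n)
  choose K hKR hK next hnext hnextcl hnextμ using
    fun (O : {O : Set (ProbabilityMeasure Z) // IsOpen O ∧ (j ⁻¹' O).Nonempty}) (n : ℕ) =>
    exists_nested_open ht O.2.1 O.2.2 (hGo n) (fun O' hO' hne => by
      rw [preimage_inter, hGD]
      exact (hDd n).inter_open_nonempty _ (hO'.preimage hj.continuous) hne)
      (ENNReal.pow_pos (ENNReal.inv_pos.2 ENNReal.ofNat_ne_top) n : 0 < (2 : ℝ≥0∞)⁻¹ ^ n)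
  let T : List ℕ → {O : Set (ProbabilityMeasure Z) // IsOpen O ∧ (j ⁻¹' O).Nonempty} :=
    fun s => List.rec ⟨O₀, hO₀, hUne⟩ (fun k s O => ⟨next O s.length k, hnext O s.length k⟩) s
  obtain ⟨f, hf⟩ := hR.exists_play_frequently
    (W := fun s k => (cthickening (1 / ((k : ℝ) + 1)) (K (T s) s.length))ᶜ)
    (fun s k => isClosed_cthickening.isOpen_compl)
    (fun s k l hkl => compl_subset_compl.2 (cthickening_mono (Nat.one_div_le_one_div hkl) _)) (by
      intro s y hy
      by_contra! hcon
      exact hy (hKR _ _ (mem_of_forall_mem_cthickening (hK _ _).isClosed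
        fun N => ⟨N, le_rfl, notMem_compl_iff.1 (hcon N)⟩)))
  let O : ℕ → Set (ProbabilityMeasure Z) := fun n => (T (revPrefix f n)).1
  let L : ℕ → Set Z := fun n => K (T (revPrefix f n)) (revPrefix f n).length
  have hOcl : ∀ n, closure (O (n + 1)) ⊆ O n ∩ G n := by
    intro n
    exact (hnextcl (T (revPrefix f n)) (revPrefix f n).length (f n)).trans
      (inter_subset_inter_right _ (by rw [length_revPrefix]))
  have hOμ : ∀ n, ∀ μ ∈ closure (O (n + 1)),
      (μ : Measure Z) (thickening (1 / ((f n : ℝ) + 1)) (L n))ᶜ < 2⁻¹ ^ n := by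
    intro n μ hμ
    exact (hnextμ (T (revPrefix f n)) (revPrefix f n).length (f n) μ hμ).trans_eq
      (by rw [length_revPrefix])
  obtain ⟨μ, hμ⟩ := IsCompact.nonempty_iInter_of_sequence_nonempty_isCompact_isClosed
    (fun n => closure (range j ∩ O n))
    (fun n => closure_mono (inter_subset_inter_right _
      (subset_closure.trans ((hOcl n).trans inter_subset_left))))
    (fun n => by
      obtain ⟨c, hc⟩ := (T (revPrefix f n)).2.2
      exact ⟨j c, subset_closure ⟨mem_range_self c, hc⟩⟩)
    isClosed_closure.isCompact fun n => isClosed_closure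
  rw [mem_iInter] at hμ
  have hμO : ∀ n, μ ∈ closure (O n) := fun n => closure_mono inter_subset_right (hμ n)
  have hμt : IsTightOn R μ := by
    intro ε hε
    have hsum : ∑' n : ℕ, (2 : ℝ≥0∞)⁻¹ ^ n ≠ ∞ := by
      rw [ENNReal.tsum_geometric, ENNReal.one_sub_inv_two, inv_inv]
      exact ENNReal.ofNat_ne_top
    obtain ⟨m, hm⟩ := ((ENNReal.tendsto_sum_nat_add _ hsum).eventually_lt_const hε).exists
    let Q := ⋂ n, cthickening (1 / ((f (n + m) : ℝ) + 1)) (L (n + m))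
    refine ⟨Q, fun y hy => ?_, (isClosed_iInter fun n => isClosed_cthickening).isCompact, ?_⟩
    · by_contra hyR
      obtain ⟨n, hn, hyn⟩ := hf y hyR m
      obtain ⟨i, rfl⟩ := Nat.exists_eq_add_of_le' hn
      exact hyn (mem_iInter.1 hy i)
    · refine lt_of_le_of_lt ?_ hm
      rw [compl_iInter]
      refine (measure_iUnion_le _).trans (ENNReal.tsum_le_tsum fun n => ?_)
      exact (measure_mono (compl_subset_compl.2 (thickening_subset_cthickening _ _))).trans
        (hOμ (n + m) μ (hμO (n + m + 1))).le
  obtain ⟨c, rfl⟩ := hcl μ (closure_mono inter_subset_left (hμ 0)) hμt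
  refine ⟨c, (hOcl 0 (hμO 1)).1, mem_iInter.2 fun n => ?_⟩
  rw [← hGD]
  exact (hOcl n (hμO (n + 1))).2

variable [TopologicalSpace X] [MeasurableSpace X] [BorelSpace X]

theorem isInducing_probabilityMeasure_map [TopologicalSpace.SeparableSpace Z] {e : X → Z}
    (he : IsEmbedding e) :
    IsInducing fun μ : ProbabilityMeasure X => μ.map he.continuous.measurable.aemeasurable := by
  have : TopologicalSpace.MetrizableSpace X := he.metrizableSpace
  let _ : MetricSpace X := TopologicalSpace.metrizableSpaceMetric X
  refine isInducing_iff_nhds.2 fun μ => le_antisymm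
    (ProbabilityMeasure.continuous_map he.continuous).continuousAt.tendsto.le_comap ?_
  refine tendsto_of_forall_isOpen_le_liminf' (μs := id) (L := comap
    (fun μ : ProbabilityMeasure X => μ.map he.continuous.measurable.aemeasurable)
    (𝓝 (μ.map he.continuous.measurable.aemeasurable))) fun U hU => ?_
  obtain ⟨V, hV, rfl⟩ := he.isInducing.isOpen_iff.1 hU
  have := ProbabilityMeasure.le_liminf_measure_open_of_tendsto
    (tendsto_comap (f := fun μ : ProbabilityMeasure X =>
      μ.map he.continuous.measurable.aemeasurable)
      (x := 𝓝 (μ.map he.continuous.measurable.aemeasurable))) hV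
  simpa [ProbabilityMeasure.toMeasure_map,
    Measure.map_apply he.continuous.measurable hV.measurableSet] using this

theorem isTightOn_map [T2Space X] {e : X → Z} (he : Continuous e) {μ : ProbabilityMeasure X}
    (hμ : μ.toMeasure.InnerRegular) :
    IsTightOn (range e) (μ.map he.measurable.aemeasurable) := by
  intro ε hε
  obtain ⟨K, -, hK, hKε⟩ :=
    MeasurableSet.univ.exists_isCompact_sdiff_lt (measure_ne_top μ.toMeasure univ) hε.ne'
  have hKm : MeasurableSet (e '' K)ᶜ := (hK.image he).isClosed.measurableSet.compl
  refine ⟨e '' K, image_subset_range e K, hK.image he, ?_⟩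
  rw [ProbabilityMeasure.toMeasure_map, Measure.map_apply he.measurable hKm]
  refine (measure_mono ?_).trans_lt hKε
  exact fun x hx => ⟨mem_univ x, fun hxK => hx (mem_image_of_mem e hxK)⟩

theorem exists_innerRegular_map_eq [CompactSpace Z] {e : X → Z} (he : IsEmbedding e)
    {μ : ProbabilityMeasure Z} (hμ : IsTightOn (range e) μ) :
    ∃ ν : ProbabilityMeasure X, ν.toMeasure.InnerRegular ∧
      ν.map he.continuous.measurable.aemeasurable = μ := by
  have hnull : (μ : Measure Z) (range e)ᶜ = 0 := by
    refine le_antisymm (le_of_forall_gt fun ε hε => ?_) zero_le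
    obtain ⟨K, hKR, -, hKε⟩ := hμ ε hε
    exact (measure_mono (compl_subset_compl.2 hKR)).trans_lt hKε
  have hrange : NullMeasurableSet (range e) (μ : Measure Z) :=
    (NullMeasurableSet.of_null hnull).of_compl
  have hpre : ∀ s : Set X, MeasurableSet s → ∃ t, MeasurableSet t ∧ e ⁻¹' t = s := by
    intro s hs
    rwa [BorelSpace.measurable_eq (α := X), he.eq_induced, borel_comap,
      ← BorelSpace.measurable_eq (α := Z)] at hs
  have himage : ∀ s, MeasurableSet s → NullMeasurableSet (e '' s) (μ : Measure Z) := by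
    intro s hs
    obtain ⟨t, ht, rfl⟩ := hpre s hs
    rw [image_preimage_eq_inter_range]
    exact ht.nullMeasurableSet.inter hrange
  let ν := (μ : Measure Z).comap e
  have hν : ∀ t, MeasurableSet t → ν (e ⁻¹' t) = (μ : Measure Z) t := by
    intro t ht
    rw [Measure.comap_apply₀ _ _ he.injective himage
      (he.continuous.measurable ht).nullMeasurableSet, image_preimage_eq_inter_range]
    exact measure_inter_conull hnull
  have hνprob : IsProbabilityMeasure ν := ⟨by
    rw [← preimage_univ (f := e), hν _ MeasurableSet.univ]
    exact measure_univ⟩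
  refine ⟨⟨ν, hνprob⟩, ⟨fun s hs r hr => ?_⟩, ?_⟩
  · obtain ⟨t, ht, rfl⟩ := hpre s hs
    change r < ν _ at hr
    rw [hν t ht] at hr
    obtain ⟨ε, hε, hεr⟩ : ∃ ε, 0 < ε ∧ r + ε < (μ : Measure Z) t := by
      obtain ⟨q, hrq, hq⟩ := exists_between hr
      exact ⟨q - r, tsub_pos_of_lt hrq, by rwa [add_tsub_cancel_of_le hrq.le]⟩
    obtain ⟨K, hKR, hK, hKε⟩ := hμ ε hε
    have hrK : r < (μ : Measure Z) (t ∩ K) := by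
      by_contra! hcon
      refine hεr.not_ge ((measure_le_inter_add_sdiff _ t K).trans (add_le_add hcon ?_))
      exact (measure_mono fun z hz => hz.2).trans hKε.le
    obtain ⟨Q, hQ, hQc, hrQ⟩ := (ht.inter hK.measurableSet).exists_lt_isCompact hrK
    refine ⟨e ⁻¹' Q, preimage_mono (hQ.trans inter_subset_left),
      he.isInducing.isCompact_preimage' hQc ((hQ.trans inter_subset_right).trans hKR), ?_⟩
    change r < ν _
    rwa [hν Q hQc.measurableSet]
  · ext t ht
    change ((μ : Measure Z).comap e).map e t = _
    rw [Measure.map_apply he.continuous.measurable ht]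
    exact hν t ht

end Measure

theorem exists_isEmbedding_denseRange_compact (X : Type*) [TopologicalSpace X]
    [TopologicalSpace.SeparableSpace X] [TopologicalSpace.MetrizableSpace X] :
    ∃ (Z : Type) (_ : MetricSpace Z) (_ : CompactSpace Z) (e : X → Z),
      IsEmbedding e ∧ DenseRange e := by
  let _ : MetricSpace X := TopologicalSpace.metrizableSpaceMetric X
  obtain ⟨F, hF⟩ := Metric.PiNatEmbed.exists_embedding_to_hilbert_cube (X := X)
  let _ : MetricSpace (ℕ → unitInterval) := TopologicalSpace.metrizableSpaceMetric _
  refine ⟨closure (range F), inferInstance, isCompact_iff_compactSpace.1 isClosed_closure.isCompact,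
    codRestrict F _ fun x => subset_closure (mem_range_self x), hF.codRestrict _ _, ?_⟩
  intro z
  rw [closure_subtype, ← range_comp]
  exact z.2

end

/-- If `X` is separable metrizable and its Vietoris hyperspace `K(X)` is
hereditarily Baire, then the space `P_r(X)` of Radon (inner regular by compact
sets) Borel probability measures on `X` with the weak topology is hereditarily
Baire. -/
theorem radon_measures_hereditarilyBaire_of_hyperspace {X : Type*}
    [TopologicalSpace X] [TopologicalSpace.SeparableSpace X]
    [TopologicalSpace.MetrizableSpace X] [MeasurableSpace X] [BorelSpace X]
    (h : HereditarilyBaire (Hyper X)) :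
    HereditarilyBaire {μ : ProbabilityMeasure X // μ.toMeasure.InnerRegular} := by
  intro C hC
  rcases isEmpty_or_nonempty C with hCe | ⟨⟨⟨c, hcr⟩, hc⟩⟩
  · infer_instance
  have hX : Nonempty X := nonempty_of_isProbabilityMeasure c.toMeasure
  obtain ⟨Z, _, _, e, he, hd⟩ := exists_isEmbedding_denseRange_compact X
  borelize Z
  have hι := (isInducing_probabilityMeasure_map he).comp
    (Topology.IsInducing.subtypeVal (t := {μ : ProbabilityMeasure X | μ.toMeasure.InnerRegular}))
  refine baireSpace_of_isTightOn (hι.comp Topology.IsInducing.subtypeVal)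
    (isMengerSet_compl_range he hd h) (fun μ => isTightOn_map he.continuous μ.1.2) ?_
  intro μ hμ hμt
  obtain ⟨ν, hν, rfl⟩ := exists_innerRegular_map_eq he hμt
  refine ⟨⟨⟨ν, hν⟩, ?_⟩, rfl⟩
  rw [← hC.closure_eq, hι.closure_eq_preimage_closure_image]
  rwa [Set.range_comp, Subtype.range_coe] at hμ
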